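/- Consider n = 2 agents and m = 2 items with normalized valuations: agent i's valuation is (t_i, 1 - t_i) with t_i ∈ [0,1], and the prior for each agent draws t_i uniformly from [0,1] independently. Let f : ℝ²_{≥0} → ℝ be any anonymous, strictly monotone welfare function satisfying the Pigou-Dalton principle. Then there is no deterministic measurable mechanism x mapping reported pairs (b_1, b_2) ∈ [0,1]² to allocations of the two items such that (1) for every reported pair, the output allocation maximizes f(u_1, u_2) over all allocations, where utilities are computed with respect to the reported valuations, and (2) x is Bayesian incentive compatible for this uniform prior, i.e., for every agent i, true value t_i, and report b_i, E_{t_{-i} ~ U[0,1]}[u_i(x(t_i, t_{-i}))] ≥ E_{t_{-i} ~ U[0,1]}[u_i(x(b_i, t_{-i}))], with u_i measured under t_i. -/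

import Mathlib

open MeasureTheory


/-- The normalized valuation `(t, 1 - t)` over the two items. -/
noncomputable def val2 (t : ℝ) : Fin 2 → ℝ := fun j => if j = 0 then t else 1 - t

/-- Utility of a bundle of (some of) the two items under the valuation `(t, 1 - t)`. -/
noncomputable def util2 (t : ℝ) (a : Fin 2 → Bool) : ℝ :=
  ∑ j : Fin 2, if a j then val2 t j else 0

/-- An allocation of the two items among the two agents: each item goes to exactly one agent. -/
def IsAlloc2 (a : Fin 2 → Fin 2 → Bool) : Prop :=
  ∀ j : Fin 2, ∃! i : Fin 2, a i j = true

/-- `f` is anonymous (symmetric) on nonnegative utility profiles. -/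
def Anonymous (f : ℝ → ℝ → ℝ) : Prop :=
  ∀ a b : ℝ, 0 ≤ a → 0 ≤ b → f a b = f b a

/-- `f` is strictly monotone on nonnegative utility profiles: coordinatewise weakly larger
and not equal implies strictly larger welfare. -/
def StrictlyMonotoneWelfare (f : ℝ → ℝ → ℝ) : Prop :=
  ∀ a b a' b' : ℝ, 0 ≤ a' → 0 ≤ b' → a' ≤ a → b' ≤ b → (a, b) ≠ (a', b') → f a' b' < f a b

/-- The Pigou–Dalton principle on nonnegative utility profiles: a mean-preserving
reduction of inequality between two agents weakly increases welfare. -/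
def PigouDalton (f : ℝ → ℝ → ℝ) : Prop :=
  ∀ x1 x2 y1 y2 : ℝ, 0 ≤ x2 → x1 + x2 = y1 + y2 → x2 < x1 → y1 < x1 → x2 < y1 →
    f x1 x2 ≤ f y1 y2

/-- Giving each item to the agent who values it more beats all other allocations. -/
lemma efficient_welfare_lt {f : ℝ → ℝ → ℝ} (hanon : Anonymous f)
    (hmono : StrictlyMonotoneWelfare f) (hpd : PigouDalton f) {t s : ℝ}
    (hs : 0 ≤ s) (hst : s < t) (ht : t ≤ 1) :
    f 1 0 < f t (1 - s) ∧ f 0 1 < f t (1 - s) ∧ f (1 - t) s < f t (1 - s) := by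
  have h₁ : f t (1 - t) < f t (1 - s) :=
    hmono _ _ _ _ (by linarith) (by linarith) le_rfl (by linarith)
      (by intro h; have := congrArg Prod.snd h; simp at this; linarith)
  have h₂ : f 1 0 ≤ f t (1 - t) := by
    rcases ht.lt_or_eq with h | rfl
    · exact hpd _ _ _ _ le_rfl (by ring) one_pos h (by linarith)
    · simp
  have h₃ : f (1 - t) s < f (1 - t) t :=
    hmono _ _ _ _ (by linarith) hs le_rfl hst.le
      (by intro h; have := congrArg Prod.snd h; simp at this; linarith)
  have h₄ := hanon 0 1 le_rfl zero_le_one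
  have h₅ := hanon (1 - t) t (by linarith) (by linarith)
  exact ⟨by linarith, by linarith, by linarith⟩

lemma util2_eq (t : ℝ) (a : Fin 2 → Bool) :
    util2 t a = (if a 0 then t else 0) + (if a 1 then 1 - t else 0) := by
  simp [util2, val2, Fin.sum_univ_two]

lemma IsAlloc2.apply_one {a : Fin 2 → Fin 2 → Bool} (ha : IsAlloc2 a) (j : Fin 2) :
    a 1 j = !a 0 j := by
  obtain ⟨i, hi, hu⟩ := ha j
  cases h0 : a 0 j <;> cases h1 : a 1 j
  · exact absurd hi (by fin_cases i <;> simp [h0, h1])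
  · rfl
  · rfl
  · exact absurd ((hu 0 h0).trans (hu 1 h1).symm) (by decide)

/-- A welfare-maximizing allocation gives each item to the agent who values it more. -/
lemma maximizer_eq {f : ℝ → ℝ → ℝ} (hanon : Anonymous f)
    (hmono : StrictlyMonotoneWelfare f) (hpd : PigouDalton f) {t s : ℝ}
    (ht : t ∈ Set.Icc (0 : ℝ) 1) (hs : s ∈ Set.Icc (0 : ℝ) 1) {A : Fin 2 → Fin 2 → Bool}
    (hA : IsAlloc2 A)
    (hmax : ∀ a : Fin 2 → Fin 2 → Bool, IsAlloc2 a →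
      f (util2 t (a 0)) (util2 s (a 1)) ≤ f (util2 t (A 0)) (util2 s (A 1))) :
    (s < t → A 0 0 = true ∧ A 0 1 = false) ∧ (t < s → A 0 0 = false ∧ A 0 1 = true) := by
  obtain ⟨ht0, ht1⟩ := ht
  obtain ⟨hs0, hs1⟩ := hs
  have e₁ := hmax (fun i j => decide (i = j)) (by intro j; exact ⟨j, by simp, by simp⟩)
  have e₂ := hmax (fun i j => decide (i ≠ j)) (by
    intro j; exact ⟨1 - j, by revert j; decide, by revert j; decide⟩)
  have hA0 := hA.apply_one 0
  have hA1 := hA.apply_one 1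
  simp only [util2_eq, hA0, hA1] at e₁ e₂
  constructor
  · intro h
    obtain ⟨h₁, h₂, h₃⟩ := efficient_welfare_lt hanon hmono hpd hs0 h ht1
    cases h0 : A 0 0 <;> cases h1 : A 0 1 <;> simp [h0, h1] at e₁ ⊢ <;> linarith
  · intro h
    obtain ⟨h₁, h₂, h₃⟩ := efficient_welfare_lt hanon hmono hpd (t := 1 - t) (s := 1 - s)
      (by linarith) (by linarith) (by linarith)
    simp only [sub_sub_cancel] at h₁ h₂ h₃
    cases h0 : A 0 0 <;> cases h1 : A 0 1 <;> simp [h0, h1] at e₂ ⊢ <;> linarith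

/-- For two agents with normalized valuations `(t_i, 1 - t_i)`, `t_i` drawn i.i.d.
uniformly from `[0,1]`, and any anonymous, strictly monotone welfare function `f`
satisfying the Pigou–Dalton principle: no deterministic measurable mechanism both
ex-post maximizes `f` (w.r.t. the reported valuations, on every reported pair in
`[0,1]²`) and is Bayesian incentive compatible for this uniform prior. -/
theorem stmt13 (f : ℝ → ℝ → ℝ) (hanon : Anonymous f)
    (hmono : StrictlyMonotoneWelfare f) (hpd : PigouDalton f) :
    ¬ ∃ M : (Fin 2 → ℝ) → (Fin 2 → Fin 2 → Bool),
        Measurable M ∧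
        (∀ b : Fin 2 → ℝ, (∀ i, b i ∈ Set.Icc (0 : ℝ) 1) →
          IsAlloc2 (M b) ∧
            ∀ a : Fin 2 → Fin 2 → Bool, IsAlloc2 a →
              f (util2 (b 0) (a 0)) (util2 (b 1) (a 1)) ≤
                f (util2 (b 0) (M b 0)) (util2 (b 1) (M b 1))) ∧
        (∀ (i : Fin 2) (t r : ℝ), t ∈ Set.Icc (0 : ℝ) 1 → r ∈ Set.Icc (0 : ℝ) 1 →
          ∫ s in Set.Icc (0 : ℝ) 1, util2 t (M (fun i' => if i' = i then r else s) i) ≤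
            ∫ s in Set.Icc (0 : ℝ) 1, util2 t (M (fun i' => if i' = i then t else s) i)) := by
  rintro ⟨M, -, hM, hbic⟩
  have key : ∀ r ∈ Set.Icc (0 : ℝ) 1, ∀ s ∈ Set.Icc (0 : ℝ) 1, s ≠ r →
      util2 (3 / 4) (M (fun i => if i = 0 then r else s) 0) =
        1 / 4 + (Set.Iio r).indicator (fun _ => (1 / 2 : ℝ)) s := by
    intro r hr s hs hne
    obtain ⟨hA, hmax⟩ := hM (fun i => if i = 0 then r else s)
      (by intro i; split_ifs <;> assumption)
    obtain ⟨h₁, h₂⟩ := maximizer_eq hanon hmono hpd hr hs hA (by simpa using hmax)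
    rcases hne.lt_or_gt with h | h
    · obtain ⟨h0, h1⟩ := h₁ h
      rw [util2_eq, h0, h1, Set.indicator_of_mem (by exact h)]
      norm_num
    · obtain ⟨h0, h1⟩ := h₂ h
      rw [util2_eq, h0, h1, Set.indicator_of_notMem (by simpa using h.le)]
      norm_num
  have integral_eq : ∀ r ∈ Set.Icc (0 : ℝ) 1,
      ∫ s in Set.Icc (0 : ℝ) 1, util2 (3 / 4) (M (fun i => if i = 0 then r else s) 0) =
        1 / 4 + r / 2 := by
    intro r hr
    have hae : ∀ᵐ s : ℝ, s ≠ r := by simp [ae_iff]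
    rw [setIntegral_congr_ae measurableSet_Icc
        (hae.mono fun s hne hs => key r hr s hs hne),
      integral_add (by simp) ((integrable_const _).indicator measurableSet_Iio),
      setIntegral_indicator measurableSet_Iio]
    have hset : Set.Icc (0 : ℝ) 1 ∩ Set.Iio r = Set.Ico 0 r := by
      ext s
      simp only [Set.mem_inter_iff, Set.mem_Icc, Set.mem_Iio, Set.mem_Ico]
      exact ⟨fun h => ⟨h.1.1, h.2⟩, fun h => ⟨⟨h.1, h.2.le.trans hr.2⟩, h.2⟩⟩
    simp [hset, hr.1]
    ring
  have h := hbic 0 (3 / 4) 1 (by norm_num) (by norm_num)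
  rw [integral_eq 1 (by norm_num), integral_eq (3 / 4) (by norm_num)] at h
  norm_num at h
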